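/- (Structure of the Bernstein-Bezier lift matrix, Section 3.1.2.) Let d ≥ 2 and N ≥ 0. Work on the unit d-simplex T_d with face F = {x ∈ T_d : x_1 = 0}; for a volume multi-index γ : Fin (d+1) → ℕ with |γ| = N, write a := γ_0 (the component for the barycentric coordinate λ_0 = x_1 vanishing on F) and γ̂ : Fin d → ℕ for the remaining components, so |γ̂| = N − a. Let Ẽ denote the (d−1)-dimensional elevation matrices (multi-indices over Fin d), set L_0 := (N+1)² (Ẽ^{N+1}_N)ᵀ Ẽ^{N+1}_N and ℓ_j := (−1)^j · binom(N,j)/(1+j) for 0 ≤ j ≤ N, and define the lift matrix L^f by L^f_{γ,β} := ℓ_{γ_0} · ((Ẽ^N_{N−γ_0})ᵀ L_0)_{γ̂,β} for face multi-indices β : Fin d → ℕ of weight N (with Ẽ^N_N the identity). Then M^N L^f = M^f, i.e., for every volume multi-index α of weight N and every face multi-index β of weight N: Σ_{|γ|=N} (∫_{T_d} b^N_α b^N_γ dx) · ℓ_{γ_0} · ((Ẽ^N_{N−γ_0})ᵀ L_0)_{γ̂,β} = ∫_{T_{d−1}} b^N_α(0,y) b̃^N_β(y) dy, where b̃^N_β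 is the (d−1)-dimensional Bernstein basis function on T_{d−1}. -/

import Mathlib

open MeasureTheory

/-- The unit `n`-simplex `T_n = {x ∈ ℝ^n : x_i ≥ 0, Σ x_i ≤ 1}`. -/
def unitSimplex (n : ℕ) : Set (Fin n → ℝ) := {x | (∀ i, 0 ≤ x i) ∧ ∑ i, x i ≤ 1}

/-- Barycentric coordinates `λ(x) = (x_1, …, x_n, 1 − Σ_i x_i)` of `x ∈ ℝ^n`
(indexed by `Fin (n+1)`, with `λ_0 = x_1`). -/
noncomputable def bary (n : ℕ) (x : Fin n → ℝ) : Fin (n + 1) → ℝ :=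
  Fin.snoc x (1 - ∑ i, x i)

/-- The Bernstein basis function `b^N_α(x) = (N!/∏_j α_j!) · ∏_j λ(x)_j^{α_j}` on `ℝ^n`,
for a multi-index `α : Fin (n+1) → ℕ`. -/
noncomputable def bernFn (n N : ℕ) (α : Fin (n + 1) → ℕ) (x : Fin n → ℝ) : ℝ :=
  ((N.factorial : ℝ) / ∏ j, ((α j).factorial : ℝ)) * ∏ j, bary n x j ^ α j

/-- Entry `(β, α)` of the one-degree elevation matrix `Ẽ^m_{m−1}` (real entries) for
multi-indices over `Fin n`: `(α_j + 1)/m` if `β = α + e_j` for some `j`, `0` otherwise. -/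
noncomputable def elevEntryR (n m : ℕ) (β α : Fin n → ℕ) : ℝ :=
  ∑ j, if β = α + Pi.single j 1 then ((α j : ℝ) + 1) / (m : ℝ) else 0

/-- Entry `(β, α)` of the composite elevation matrix
`Ẽ^N_{N−i} = Ẽ^N_{N−1} Ẽ^{N−1}_{N−2} ⋯ Ẽ^{N−i+1}_{N−i}` (with `Ẽ^N_N` the identity),
for multi-indices over `Fin n` (`β` of weight `N`, `α` of weight `N−i`). -/
noncomputable def elevComp (n N : ℕ) : ℕ → (Fin n → ℕ) → (Fin n → ℕ) → ℝ
  | 0, β, α => if β = α then 1 else 0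
  | i + 1, β, α => ∑ γ ∈ Finset.Nat.antidiagonalTuple n (N - i),
      elevComp n N i β γ * elevEntryR n (N - i) γ α

/-- Entry `(δ, β)` of `L_0 := (N+1)² (Ẽ^{N+1}_N)ᵀ Ẽ^{N+1}_N` for face multi-indices
`δ, β` over `Fin n` of weight `N`. -/
noncomputable def L0ent (n N : ℕ) (δ β : Fin n → ℕ) : ℝ :=
  ((N + 1 : ℕ) : ℝ) ^ 2 *
    ∑ γ ∈ Finset.Nat.antidiagonalTuple n (N + 1),
      elevEntryR n (N + 1) γ δ * elevEntryR n (N + 1) γ β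

/-- The scaling constants `ℓ_j = (−1)^j · binom(N,j)/(1+j)`. -/
noncomputable def liftCoef (N j : ℕ) : ℝ := (-1 : ℝ) ^ j * (N.choose j : ℝ) / (1 + j : ℝ)


theorem sum_adT_succ {M : Type*} [AddCommMonoid M] (k n : ℕ) (F : (Fin (k+1) → ℕ) → M) :
    ∑ γ ∈ Finset.Nat.antidiagonalTuple (k+1) n, F γ
      = ∑ p ∈ Finset.HasAntidiagonal.antidiagonal n, ∑ x ∈ Finset.Nat.antidiagonalTuple k p.2,
          F (Fin.cons p.1 x) := by
  rw [Finset.sum_sigma']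
  refine Finset.sum_bij' (fun γ _ => ⟨(γ 0, ∑ i, Fin.tail γ i), Fin.tail γ⟩)
    (fun p _ => Fin.cons p.1.1 p.2) ?_ ?_ ?_ ?_ ?_
  · intro γ hγ
    simp only [Finset.Nat.mem_antidiagonalTuple, Fin.sum_univ_succ] at hγ
    simp [Finset.Nat.mem_antidiagonalTuple, Fin.tail, hγ]
  · rintro ⟨⟨a, b⟩, x⟩ h
    simp only [Finset.mem_sigma, Finset.HasAntidiagonal.mem_antidiagonal, Finset.Nat.mem_antidiagonalTuple] at h
    simp [Finset.Nat.mem_antidiagonalTuple, Fin.sum_univ_succ, h.1, h.2]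
  · intro γ hγ
    simp
  · rintro ⟨⟨a, b⟩, x⟩ h
    simp only [Finset.mem_sigma, Finset.HasAntidiagonal.mem_antidiagonal, Finset.Nat.mem_antidiagonalTuple] at h
    obtain ⟨h1, rfl⟩ := h
    simp
  · intro γ hγ
    simp

open Polynomial in
theorem coeff_prod_fin (k n : ℕ) (h : Fin k → ℝ[X]) :
    (∏ i, h i).coeff n = ∑ γ ∈ Finset.Nat.antidiagonalTuple k n, ∏ i, (h i).coeff (γ i) := by
  induction k generalizing n with
  | zero =>
    cases n with
    | zero => simp
    | succ n => simp [Polynomial.coeff_one]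
  | succ k ih =>
    rw [sum_adT_succ, Fin.prod_univ_succ, Polynomial.coeff_mul]
    refine Finset.sum_congr rfl fun p _ => ?_
    rw [ih, Finset.mul_sum]
    refine Finset.sum_congr rfl fun x _ => ?_
    rw [Fin.prod_univ_succ]
    simp

open Polynomial in
noncomputable def lam (f : ℕ → ℝ) : ℝ[X] →ₗ[ℝ] ℝ :=
  Polynomial.lsum (fun n => ((-1)^n * f n) • LinearMap.id)

open Polynomial in
theorem lam_step (f : ℕ → ℝ) (H : ℝ[X]) :
    lam f ((1 + X) * H) = lam (fun n => f n - f (n+1)) H := by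
  induction H using Polynomial.induction_on' with
  | add p q hp hq => rw [mul_add, map_add, map_add, hp, hq]
  | monomial n a =>
    rw [add_mul, one_mul, map_add, X_mul_monomial]
    simp [lam, Polynomial.lsum_apply, Polynomial.sum_monomial_index]
    ring

open Polynomial in
theorem lam_choose (r : ℕ) (z : ℤ) (H : ℝ[X]) (h : (1 + X)^(r+1) ∣ H) :
    lam (fun c => ((Ring.choose (z - c) r : ℤ) : ℝ)) H = 0 := by
  induction r generalizing H z with
  | zero =>
    obtain ⟨G, rfl⟩ := h
    rw [zero_add, pow_one, lam_step]
    simp [lam, Polynomial.lsum_apply, Polynomial.sum_def]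
  | succ r ih =>
    obtain ⟨G, rfl⟩ := h
    rw [pow_succ', mul_assoc, lam_step]
    rw [← ih (z-1) _ (dvd_mul_right _ G)]
    congr 2
    funext c
    have := Ring.choose_succ_succ (z - 1 - c) r
    rw [show z - 1 - (c:ℤ) + 1 = z - c by ring] at this
    rw [this]
    push_cast
    rw [show z - ((c:ℤ) + 1) = z - 1 - c by ring]
    ring

open Polynomial in
noncomputable def hpoly (a η : ℕ) : ℝ[X] := hasseDeriv a (X^a * (1 + X)^η)

theorem hpoly_coeff (a η c : ℕ) :
    (hpoly a η).coeff c = ((a + c).choose a : ℝ) * (η.choose c) := by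
  rw [hpoly, Polynomial.hasseDeriv_coeff, Polynomial.coeff_X_pow_mul, Polynomial.coeff_one_add_X_pow,
    add_comm c a]

open Polynomial in
theorem hpoly_dvd (a η : ℕ) : (1 + X)^(η - a) ∣ hpoly a η := by
  have h := pow_sub_dvd_iterate_derivative_of_pow_dvd (R := ℝ) (p := X^a * (1+X)^η) a
    (dvd_mul_left ((1 + X)^η) (X^a))
  rw [← factorial_smul_hasseDeriv] at h
  have h2 : hpoly a η = C ((a.factorial : ℝ)⁻¹) * ((a.factorial • hasseDeriv a) (X^a * (1+X)^η) : ℝ[X]) := by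
    rw [hpoly, LinearMap.smul_apply, nsmul_eq_mul, ← mul_assoc, ← C_eq_natCast, ← C_mul,
      inv_mul_cancel₀ (by positivity), C_1, one_mul]
  rw [h2]
  exact Dvd.dvd.mul_left h _

theorem comb_key (k N r : ℕ) (a η : Fin k → ℕ) (ha : r + ∑ i, a i = N) (hη : ∑ i, η i = N + 1) :
    ∑ p ∈ Finset.HasAntidiagonal.antidiagonal N, ∑ x ∈ Finset.Nat.antidiagonalTuple k p.2,
      (-1:ℝ)^p.1 * ((r + p.1).choose r : ℝ) *
        ∏ i, (((a i + x i).choose (a i) : ℝ) * ((η i).choose (x i) : ℝ))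
     = if r = 0 then ∏ i, ((a i + η i).choose (a i) : ℝ) else 0 := by
  classical
  set H : Polynomial ℝ := ∏ i, hpoly (a i) (η i) with hH
  have hc : ∀ c, H.coeff c = ∑ x ∈ Finset.Nat.antidiagonalTuple k c,
      ∏ i, (((a i + x i).choose (a i) : ℝ) * ((η i).choose (x i) : ℝ)) := by
    intro c
    rw [hH, coeff_prod_fin]
    simp only [hpoly_coeff]
  have hdeg : H.natDegree < N + 2 := by
    rw [Nat.lt_succ_iff, hH]
    refine (Polynomial.natDegree_prod_le _ _).trans ?_
    rw [← hη]
    refine Finset.sum_le_sum fun i _ => ?_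
    rw [Polynomial.natDegree_le_iff_coeff_eq_zero]
    intro n hn
    rw [hpoly_coeff, Nat.choose_eq_zero_of_lt hn]; simp
  have htop : H.coeff (N+1) = ∏ i, ((a i + η i).choose (a i) : ℝ) := by
    rw [hc, Finset.sum_eq_single η]
    · simp
    · intro x hx hne
      rw [Finset.Nat.mem_antidiagonalTuple] at hx
      have : ∃ i, η i < x i := by
        by_contra hcon
        push Not at hcon
        apply hne
        have := (Finset.sum_eq_sum_iff_of_le (s := Finset.univ) (f := x) (g := η)
          (fun i _ => hcon i)).1 (by rw [hx, hη])
        funext i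
        exact this i (Finset.mem_univ i)
      obtain ⟨i, hi⟩ := this
      refine Finset.prod_eq_zero (Finset.mem_univ i) ?_
      rw [Nat.choose_eq_zero_of_lt hi]; simp
    · intro h
      exact absurd (Finset.Nat.mem_antidiagonalTuple.2 hη) h
  have hdvd : (1 + Polynomial.X)^(r+1) ∣ H := by
    have h1 : (1 + Polynomial.X : Polynomial ℝ)^(∑ i, (η i - a i)) ∣ H := by
      rw [← Finset.prod_pow_eq_pow_sum]
      exact Finset.prod_dvd_prod_of_dvd _ _ fun i _ => hpoly_dvd _ _
    refine (pow_dvd_pow _ ?_).trans h1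
    have h2 : ∑ i, η i ≤ ∑ i, (η i - a i) + ∑ i, a i := by
      rw [← Finset.sum_add_distrib]
      exact Finset.sum_le_sum fun i _ => by omega
    omega
  have h0 := lam_choose r ((r + N : ℕ) : ℤ) H hdvd
  rw [lam, Polynomial.lsum_apply, Polynomial.sum_over_range' _ (by simp) (N+2) hdeg,
    Finset.sum_range_succ] at h0
  simp only [← Finset.mul_sum, ← hc]
  have hA : ∑ p ∈ Finset.HasAntidiagonal.antidiagonal N,
      (-1:ℝ)^p.1 * ((r + p.1).choose r : ℝ) * H.coeff p.2
      = ∑ x ∈ Finset.range (N+1), (-1:ℝ)^(N-x) * ((r + (N - x)).choose r : ℝ) * H.coeff x := by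
    rw [Finset.Nat.antidiagonal_eq_map', Finset.sum_map]
    rfl
  rw [hA]
  clear hA
  have e1 : ∀ c ∈ Finset.range (N+1), (((-1:ℝ)^c * ((Ring.choose (((r + N : ℕ) : ℤ) - c) r : ℤ) : ℝ)) •
      (LinearMap.id : ℝ →ₗ[ℝ] ℝ)) (H.coeff c)
      = (-1)^N * ((-1)^(N-c) * ((r + (N - c)).choose r : ℝ) * H.coeff c) := by
    intro c hcr
    have hcN : c ≤ N := by simpa [Nat.lt_succ_iff] using hcr
    rw [show (((r + N : ℕ) : ℤ) - c) = ((r + (N - c) : ℕ) : ℤ) by omega, Ring.choose_natCast]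
    have : (-1:ℝ)^N * (-1)^(N-c) = (-1)^c := by
      rw [← pow_add, show N + (N - c) = c + 2 * (N - c) by omega, pow_add, pow_mul]; simp
    simp only [LinearMap.smul_apply, LinearMap.id_apply, smul_eq_mul]
    rw [← this]; push_cast; ring
  rw [Finset.sum_congr rfl e1, ← Finset.mul_sum, htop] at h0
  have e2 : ((Ring.choose (((r + N : ℕ) : ℤ) - ((N+1 : ℕ):ℤ)) r : ℤ) : ℝ) = if r = 0 then 1 else 0 := by
    rcases r with _ | r
    · simp
    · rw [show (((r + 1 + N : ℕ) : ℤ) - ((N+1 : ℕ):ℤ)) = (r:ℕ) by push_cast; ring, Ring.choose_natCast]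
      simp
  rw [e2] at h0
  simp only [LinearMap.smul_apply, LinearMap.id_apply, smul_eq_mul] at h0
  have hN : (-1:ℝ)^N ≠ 0 := by simp
  generalize (∑ x ∈ Finset.range (N+1), (-1:ℝ)^(N-x) * ((r + (N - x)).choose r : ℝ) * H.coeff x) = S at *
  generalize (∏ i, ((a i + η i).choose (a i) : ℝ)) = P at *
  apply mul_left_cancel₀ hN
  split_ifs at h0 ⊢
  · rw [pow_succ] at h0; linarith
  · simpa using h0

theorem beta_int (m a : ℕ) (s : ℝ) :
    ∫ x in (0:ℝ)..s, x^a * (s-x)^m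
      = (a.factorial : ℝ) * m.factorial / (a+m+1).factorial * s^(a+m+1) := by
  induction m generalizing a with
  | zero =>
    simp [integral_pow, Nat.factorial_succ]
    field_simp
  | succ m ih =>
    have hd : ∀ x ∈ Set.uIcc (0:ℝ) s, HasDerivAt (fun x : ℝ => x^(a+1) * (s-x)^(m+1))
        (((a:ℝ)+1) * (x^a * (s-x)^(m+1)) - ((m:ℝ)+1) * (x^(a+1) * (s-x)^m)) x := by
      intro x _
      have h1 := hasDerivAt_pow (a+1) x
      have h2 := (((hasDerivAt_id x).const_sub s)).pow (m+1)
      have := h1.mul h2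
      have e : (((a:ℝ)+1) * (x^a * (s-x)^(m+1)) - ((m:ℝ)+1) * (x^(a+1) * (s-x)^m))
          = (((a + 1 : ℕ) : ℝ) * x ^ (a + 1 - 1) * (s - x) ^ (m + 1) +
            x ^ (a + 1) * (((m + 1 : ℕ) : ℝ) * (s - x) ^ (m + 1 - 1) * -1)) := by
        push_cast
        ring
      rw [e]
      exact this
    have hi := intervalIntegral.integral_eq_sub_of_hasDerivAt hd
      (by apply Continuous.intervalIntegrable; fun_prop)
    rw [intervalIntegral.integral_sub (by apply Continuous.intervalIntegrable; fun_prop)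
      (by apply Continuous.intervalIntegrable; fun_prop), intervalIntegral.integral_const_mul,
      intervalIntegral.integral_const_mul, ih] at hi
    simp only [sub_self, ne_eq, Nat.add_eq_zero_iff, one_ne_zero, and_false, not_false_eq_true,
      zero_pow, mul_zero, zero_mul] at hi
    have ha : (a:ℝ) + 1 ≠ 0 := by positivity
    have : ∫ x in (0:ℝ)..s, x^a * (s-x)^(m+1) = ((m:ℝ)+1) * (((a+1).factorial : ℝ) * m.factorial / (a+1+m+1).factorial * s^(a+1+m+1)) / (a+1) := by
      rw [eq_div_iff ha]; linarith
    rw [this, show a + 1 + m + 1 = a + (m+1) + 1 by ring]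
    rw [Nat.factorial_succ a, Nat.factorial_succ m]
    push_cast
    field_simp

/-- scaled simplex -/
def sSimp (n : ℕ) (s : ℝ) : Set (Fin n → ℝ) := {x | (∀ i, 0 ≤ x i) ∧ ∑ i, x i ≤ s}

theorem sSimp_closed (n : ℕ) (s : ℝ) : IsClosed (sSimp n s) := by
  have : sSimp n s = (⋂ i, {x | 0 ≤ x i}) ∩ {x | ∑ i, x i ≤ s} := by
    ext x; simp [sSimp]
  rw [this]
  refine IsClosed.inter (isClosed_iInter fun i => isClosed_le (by fun_prop) (by fun_prop))
    (isClosed_le (by fun_prop) (by fun_prop))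

theorem sSimp_compact (n : ℕ) (s : ℝ) : IsCompact (sSimp n s) := by
  refine (isCompact_Icc (a := (0 : Fin n → ℝ)) (b := fun _ => s)).of_isClosed_subset
    (sSimp_closed n s) ?_
  rintro x ⟨h1, h2⟩
  refine ⟨h1, fun i => le_trans ?_ h2⟩
  exact Finset.single_le_sum (fun i _ => h1 i) (Finset.mem_univ i)

theorem dirichlet (n : ℕ) (s : ℝ) (hs : 0 ≤ s) (a : Fin n → ℕ) (b : ℕ) :
    ∫ x in sSimp n s, (∏ i, x i ^ a i) * (s - ∑ i, x i)^b
      = (∏ i, ((a i).factorial : ℝ)) * b.factorial / (n + ∑ i, a i + b).factorial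
          * s^(n + ∑ i, a i + b) := by
  induction n generalizing s with
  | zero =>
    have : sSimp 0 s = Set.univ := by
      ext x; simp [sSimp, hs]
    have hv : (volume : Measure (Fin 0 → ℝ)).real Set.univ = 1 := by
      simp [measureReal_def, volume_pi]
    rw [this]
    simp [hv]
    field_simp
  | succ n ih =>
    have hcont : Continuous (fun x : Fin (n+1) → ℝ => (∏ i, x i ^ a i) * (s - ∑ i, x i)^b) := by
      fun_prop
    have hintg := hcont.continuousOn.integrableOn_compact (μ := volume) (sSimp_compact (n+1) s)
    have hm := (sSimp_closed (n+1) s).measurableSet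
    rw [← integral_indicator hm]
    rw [← integrable_indicator_iff hm] at hintg
    have mp := (volume_preserving_piFinSuccAbove (fun _ : Fin (n + 1) => ℝ) 0).symm
    have hintg_b := mp.integrable_comp_of_integrable hintg
    rw [Measure.volume_eq_prod] at hintg_b
    rw [← mp.integral_comp' , Measure.volume_eq_prod]
    refine (integral_prod _ hintg_b).trans ?_
    have inner : ∀ x : ℝ, (∫ y : Fin n → ℝ, (sSimp (n+1) s).indicator
        (fun x : Fin (n+1) → ℝ => (∏ i, x i ^ a i) * (s - ∑ i, x i)^b)
        ((MeasurableEquiv.piFinSuccAbove (fun _ : Fin (n + 1) => ℝ) 0).symm (x, y)))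
        = (Set.Icc 0 s).indicator (fun x => ((∏ i : Fin n, ((a i.succ).factorial : ℝ)) * b.factorial
            / (n + ∑ i : Fin n, a i.succ + b).factorial) *
            (x ^ a 0 * (s - x)^(n + ∑ i : Fin n, a i.succ + b))) x := by
      intro x
      have hh : ∀ y : Fin n → ℝ, (sSimp (n+1) s).indicator
        (fun x : Fin (n+1) → ℝ => (∏ i, x i ^ a i) * (s - ∑ i, x i)^b)
        ((MeasurableEquiv.piFinSuccAbove (fun _ : Fin (n + 1) => ℝ) 0).symm (x, y))
        = (Set.Icc 0 s).indicator (fun x => x ^ a 0 * (sSimp n (s-x)).indicator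
          (fun y => (∏ i : Fin n, y i ^ a i.succ) * ((s - x) - ∑ i, y i)^b) y) x := by
        intro y
        have hy : (MeasurableEquiv.piFinSuccAbove (fun _ : Fin (n + 1) => ℝ) 0).symm (x, y)
            = Fin.cons x y := by
          simp [MeasurableEquiv.piFinSuccAbove]
          rfl
        rw [hy]
        have hmem : (Fin.cons x y : Fin (n+1) → ℝ) ∈ sSimp (n+1) s ↔
            x ∈ Set.Icc 0 s ∧ y ∈ sSimp n (s-x) := by
          simp only [sSimp, Set.mem_ofPred_eq, Fin.forall_fin_succ, Fin.cons_zero, Fin.cons_succ,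
            Fin.sum_univ_succ, Set.mem_Icc]
          constructor
          · rintro ⟨⟨h1, h2⟩, h3⟩
            have := Finset.sum_nonneg (s := Finset.univ) fun i _ => h2 i
            exact ⟨⟨h1, by linarith⟩, h2, by linarith⟩
          · rintro ⟨⟨h1, h2⟩, h3, h4⟩
            exact ⟨⟨h1, h3⟩, by linarith⟩
        by_cases h1 : x ∈ Set.Icc 0 s
        · rw [Set.indicator_of_mem h1]
          by_cases h2 : y ∈ sSimp n (s-x)
          · rw [Set.indicator_of_mem h2, Set.indicator_of_mem (hmem.2 ⟨h1, h2⟩)]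
            simp only [Fin.prod_univ_succ, Fin.sum_univ_succ, Fin.cons_zero, Fin.cons_succ]
            rw [sub_sub, mul_assoc]
          · rw [Set.indicator_of_notMem h2, Set.indicator_of_notMem (fun h => h2 (hmem.1 h).2)]
            simp
        · rw [Set.indicator_of_notMem h1, Set.indicator_of_notMem (fun h => h1 (hmem.1 h).1)]
      simp_rw [hh]
      by_cases h1 : x ∈ Set.Icc 0 s
      · simp only [Set.indicator_of_mem h1]
        rw [integral_const_mul, integral_indicator (sSimp_closed n _).measurableSet,
          ih (s - x) (by linarith [h1.2])]
        ring
      · simp only [Set.indicator_of_notMem h1, integral_zero]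
    refine (integral_congr_ae (Filter.Eventually.of_forall inner)).trans ?_
    rw [integral_indicator measurableSet_Icc, integral_Icc_eq_integral_Ioc,
      ← intervalIntegral.integral_of_le hs, intervalIntegral.integral_const_mul, beta_int]
    rw [Fin.prod_univ_succ, Fin.sum_univ_succ]
    rw [show n + 1 + (a 0 + ∑ i : Fin n, a i.succ) + b = a 0 + (n + ∑ i : Fin n, a i.succ + b) + 1 by ring]
    field_simp

theorem prod_bary (n : ℕ) (a : Fin (n+1) → ℕ) (x : Fin n → ℝ) :
    ∏ j, bary n x j ^ a j = (∏ i : Fin n, x i ^ a i.castSucc) * (1 - ∑ i, x i) ^ a (Fin.last n) := by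
  rw [Fin.prod_univ_castSucc]
  simp [bary]

theorem int_bary (n : ℕ) (a : Fin (n+1) → ℕ) :
    ∫ x in unitSimplex n, ∏ j, bary n x j ^ a j
      = (∏ j, ((a j).factorial : ℝ)) / (n + ∑ j, a j).factorial := by
  simp only [prod_bary]
  have := dirichlet n 1 zero_le_one (fun i => a i.castSucc) (a (Fin.last n))
  rw [show unitSimplex n = sSimp n 1 from rfl, this, Fin.prod_univ_castSucc, Fin.sum_univ_castSucc]
  simp [add_assoc]

theorem choose_real (a c : ℕ) :
    ((a + c).choose a : ℝ) = ((a + c).factorial : ℝ) / (a.factorial * c.factorial) := by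
  rw [Nat.cast_add_choose]

theorem int_mass (n N : ℕ) (α γ : Fin (n+1) → ℕ) (hα : ∑ j, α j = N) (hγ : ∑ j, γ j = N) :
    ∫ x in unitSimplex n, bernFn n N α x * bernFn n N γ x
      = (N.factorial : ℝ)^2 / (n + (N + N)).factorial * ∏ j, ((α j + γ j).choose (α j) : ℝ) := by
  have h : ∀ x, bernFn n N α x * bernFn n N γ x
      = ((N.factorial : ℝ) / ∏ j, ((α j).factorial : ℝ)) * ((N.factorial : ℝ) / ∏ j, ((γ j).factorial : ℝ))
        * ∏ j, bary n x j ^ (α j + γ j) := by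
    intro x
    simp only [bernFn, pow_add, Finset.prod_mul_distrib]
    ring
  simp only [h]
  rw [integral_const_mul, int_bary, Finset.sum_add_distrib, hα, hγ]
  simp only [choose_real, Finset.prod_div_distrib, Finset.prod_mul_distrib]
  field_simp

theorem bary_cons (e : ℕ) (y : Fin e → ℝ) :
    bary (e+1) (Fin.cons 0 y) = Fin.cons 0 (bary e y) := by
  unfold bary
  rw [Fin.cons_snoc_eq_snoc_cons]
  simp [Fin.sum_univ_succ]

theorem bern_cons_zero (e N : ℕ) (α : Fin (e+2) → ℕ) (h0 : α 0 = 0) (y : Fin e → ℝ) :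
    bernFn (e+1) N α (Fin.cons 0 y) = bernFn e N (fun j => α j.succ) y := by
  unfold bernFn
  rw [bary_cons, Fin.prod_univ_succ (fun j => ((α j).factorial : ℝ)),
    Fin.prod_univ_succ (fun j => (Fin.cons 0 (bary e y) : Fin (e+2) → ℝ) j ^ α j)]
  simp [h0]

theorem bern_cons_pos (e N : ℕ) (α : Fin (e+2) → ℕ) (h0 : α 0 ≠ 0) (y : Fin e → ℝ) :
    bernFn (e+1) N α (Fin.cons 0 y) = 0 := by
  unfold bernFn
  rw [bary_cons]
  rw [Fin.prod_univ_succ (fun j => (Fin.cons 0 (bary e y) : Fin (e+2) → ℝ) j ^ α j)]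
  simp [h0]

theorem prod_shift {n : ℕ} (u v : Fin n → ℝ) (j : Fin n) (c d : ℝ)
    (huv : ∀ i, i ≠ j → u i = v i) (h : c * u j = d * v j) : c * ∏ i, u i = d * ∏ i, v i := by
  classical
  rw [← Finset.mul_prod_erase _ u (Finset.mem_univ j), ← Finset.mul_prod_erase _ v (Finset.mem_univ j),
    ← mul_assoc, ← mul_assoc, h]
  congr 1
  exact Finset.prod_congr rfl fun i hi => huv i (Finset.ne_of_mem_erase hi)

theorem sum_add_single {n : ℕ} (α : Fin n → ℕ) (j : Fin n) :
    ∑ i, (α + Pi.single j 1 : Fin _ → ℕ) i = ∑ i, α i + 1 := by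
  simp [Finset.sum_add_distrib]

theorem elev_sum (n m M : ℕ) (α : Fin n → ℕ) (hα : ∑ i, α i + 1 = M) (F : (Fin n → ℕ) → ℝ) :
    ∑ γ ∈ Finset.Nat.antidiagonalTuple n M, F γ * elevEntryR n m γ α
      = ∑ j, ((α j : ℝ) + 1) / m * F (α + Pi.single j 1) := by
  simp only [elevEntryR, Finset.mul_sum]
  rw [Finset.sum_comm]
  refine Finset.sum_congr rfl fun j _ => ?_
  rw [Finset.sum_eq_single (α + Pi.single j 1)]
  · simp [mul_comm]
  · intro b _ hb
    simp [hb]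
  · intro h
    exact absurd (Finset.Nat.mem_antidiagonalTuple.2 (by rw [sum_add_single, hα])) h

theorem elev_sumT (n m M : ℕ) (η : Fin n → ℕ) (hη : ∑ i, η i = M + 1) (F : (Fin n → ℕ) → ℝ) :
    ∑ δ ∈ Finset.Nat.antidiagonalTuple n M, F δ * elevEntryR n m η δ
      = ∑ j, (η j : ℝ) / m * F (η - Pi.single j 1) := by
  simp only [elevEntryR, Finset.mul_sum]
  rw [Finset.sum_comm]
  refine Finset.sum_congr rfl fun j _ => ?_
  by_cases h0 : η j = 0
  · rw [h0]
    simp only [Nat.cast_zero, zero_div, zero_mul]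
    refine Finset.sum_eq_zero fun δ _ => ?_
    rw [if_neg, mul_zero]
    intro h
    have := congrFun h j
    simp [h0] at this
  · have hb : η - Pi.single j 1 + Pi.single j 1 = η := by
      funext i
      by_cases hi : i = j
      · subst hi; simp; omega
      · simp [hi]
    rw [Finset.sum_eq_single (η - Pi.single j 1)]
    · rw [if_pos hb.symm]
      have : (((η - Pi.single j 1 : Fin n → ℕ) j : ℕ) : ℝ) + 1 = η j := by
        have := congrFun hb j
        simp only [Pi.add_apply, Pi.single_eq_same] at this
        exact_mod_cast this
      rw [this]; ring
    · intro b _ hb2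
      rw [if_neg, mul_zero]
      rintro rfl
      apply hb2
      simp
    · intro h
      refine absurd (Finset.Nat.mem_antidiagonalTuple.2 ?_) h
      have := sum_add_single (η - Pi.single j 1 : Fin _ → ℕ) j
      rw [hb] at this
      omega

theorem choose_up (b a : ℕ) : ((a:ℝ) + 1) * (b.choose (a+1) : ℝ) = ((b:ℝ) - a) * (b.choose a : ℝ) := by
  have := Nat.choose_succ_right_eq b a
  rcases le_or_gt a b with h | h
  · have h2 : ((b.choose (a+1) * (a+1) : ℕ) : ℝ) = ((b.choose a * (b - a) : ℕ) : ℝ) := by rw [this]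
    push_cast [Nat.cast_sub h] at h2
    linarith
  · rw [Nat.choose_eq_zero_of_lt h, Nat.choose_eq_zero_of_lt (by omega)]; simp

theorem choose_down (b a : ℕ) : (b:ℝ) * ((b-1).choose a : ℝ) = ((b:ℝ) - a) * (b.choose a : ℝ) := by
  rcases b with _ | b
  · rcases a with _ | a <;> simp
  · have := Nat.add_one_mul_choose_eq b a
    rw [← choose_up]
    have h2 : (((b+1) * b.choose a : ℕ) : ℝ) = (((b+1).choose (a+1) * (a+1) : ℕ) : ℝ) := by rw [this]
    push_cast at h2
    simp
    linarith

theorem elevComp_eq (n N i : ℕ) (β α : Fin n → ℕ) (hβ : ∑ j, β j = N) (hα : ∑ j, α j + i = N) :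
    elevComp n N i β α = (∏ j, ((β j).choose (α j) : ℝ)) / (N.choose i : ℝ) := by
  induction i generalizing α with
  | zero =>
    simp only [elevComp, Nat.choose_zero_right, Nat.cast_one, div_one]
    split_ifs with h
    · subst h; simp
    · symm
      have : ∃ i, β i < α i := by
        by_contra hcon
        push Not at hcon
        apply h
        have := (Finset.sum_eq_sum_iff_of_le (s := Finset.univ) (f := α) (g := β)
          (fun i _ => hcon i)).1 (by rw [hβ]; exact hα)
        funext i
        exact (this i (Finset.mem_univ i)).symm
      obtain ⟨i, hi⟩ := this
      refine Finset.prod_eq_zero (Finset.mem_univ i) ?_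
      rw [Nat.choose_eq_zero_of_lt hi]; simp
  | succ i ih =>
    rw [elevComp]
    rw [elev_sum n (N-i) (N-i) α (by omega)]
    have h1 : ∀ j, ((α j : ℝ) + 1) / ((N - i : ℕ) : ℝ) * elevComp n N i β (α + Pi.single j 1)
        = ((β j : ℝ) - α j) * ((∏ j, ((β j).choose (α j) : ℝ)) / (((N - i : ℕ) : ℝ) * (N.choose i : ℝ))) := by
      intro j
      rw [ih _ (by rw [sum_add_single]; omega)]
      have := prod_shift (fun k => ((β k).choose ((α + Pi.single j 1 : Fin _ → ℕ) k) : ℝ))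
        (fun k => ((β k).choose (α k) : ℝ)) j ((α j : ℝ) + 1) ((β j : ℝ) - α j)
        (by intro k hk; simp [hk]) (by simpa using choose_up (β j) (α j))
      rw [div_mul_div_comm, this, mul_div_assoc]
    rw [Finset.sum_congr rfl fun j _ => h1 j, ← Finset.sum_mul, Finset.sum_sub_distrib,
      ← Nat.cast_sum, ← Nat.cast_sum, hβ]
    have h2 : (N : ℝ) - ((∑ j, α j : ℕ) : ℝ) = (i : ℝ) + 1 := by
      rw [← hα]; push_cast; ring
    rw [h2]
    have h3 := choose_up N i
    have hi : i < N := by omega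
    rw [Nat.cast_sub hi.le]
    have p1 : ((N:ℝ) - i) ≠ 0 := by
      have : (i:ℝ) < N := by exact_mod_cast hi
      linarith
    have p2 : (N.choose i : ℝ) ≠ 0 := by
      exact_mod_cast (Nat.choose_pos hi.le).ne'
    have p3 : (N.choose (i+1) : ℝ) ≠ 0 := by
      exact_mod_cast (Nat.choose_pos hi).ne'
    rw [← h3]
    field_simp

theorem lift_entry (n N a : ℕ) (g β : Fin n → ℕ) (hg : ∑ j, g j + a = N) (hβ : ∑ j, β j = N) :
    liftCoef N a * ∑ δ ∈ Finset.Nat.antidiagonalTuple n N, elevComp n N a δ g * L0ent n N δ β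
      = (-1:ℝ)^a * ∑ j, ((β j : ℝ) + 1) *
          ∏ i, (((β + Pi.single j 1 : Fin _ → ℕ) i).choose (g i) : ℝ) := by
  have h1 : ∀ δ ∈ Finset.Nat.antidiagonalTuple n N, elevComp n N a δ g * L0ent n N δ β
      = ((N + 1 : ℕ) : ℝ)^2 / (N.choose a : ℝ) * ∑ η ∈ Finset.Nat.antidiagonalTuple n (N+1),
        (∏ j, ((δ j).choose (g j) : ℝ)) * elevEntryR n (N+1) η δ * elevEntryR n (N+1) η β := by
    intro δ hδ
    rw [elevComp_eq n N a δ g (Finset.Nat.mem_antidiagonalTuple.1 hδ) hg, L0ent]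
    simp only [mul_assoc, ← Finset.mul_sum]
    ring
  have h2 : ∀ η ∈ Finset.Nat.antidiagonalTuple n (N+1),
      ∑ δ ∈ Finset.Nat.antidiagonalTuple n N,
        (∏ j, ((δ j).choose (g j) : ℝ)) * elevEntryR n (N+1) η δ * elevEntryR n (N+1) η β
      = (((a:ℝ) + 1) / ((N + 1 : ℕ) : ℝ) * ∏ j, ((η j).choose (g j) : ℝ)) * elevEntryR n (N+1) η β := by
    intro η hη
    rw [Finset.Nat.mem_antidiagonalTuple] at hη
    rw [← Finset.sum_mul, elev_sumT n (N+1) N η hη (fun δ => ∏ j, ((δ j).choose (g j) : ℝ))]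
    congr 1
    have h3 : ∀ j, (η j : ℝ) / ((N + 1 : ℕ) : ℝ) * ∏ k, (((η - Pi.single j 1 : Fin _ → ℕ) k).choose (g k) : ℝ)
        = ((η j : ℝ) - g j) * ((∏ j, ((η j).choose (g j) : ℝ)) / ((N + 1 : ℕ) : ℝ)) := by
      intro j
      have := prod_shift (fun k => (((η - Pi.single j 1 : Fin _ → ℕ) k).choose (g k) : ℝ))
        (fun k => ((η k).choose (g k) : ℝ)) j (η j : ℝ) ((η j : ℝ) - g j)
        (by intro k hk; simp [hk]) (by simpa using choose_down (η j) (g j))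
      rw [div_mul_eq_mul_div, this, mul_div_assoc]
    rw [Finset.sum_congr rfl fun j _ => h3 j, ← Finset.sum_mul, Finset.sum_sub_distrib,
      ← Nat.cast_sum, ← Nat.cast_sum, hη]
    have : ((N + 1 : ℕ) : ℝ) - ((∑ j, g j : ℕ) : ℝ) = (a : ℝ) + 1 := by
      rw [← hg]; push_cast; ring
    rw [this]
    ring
  rw [Finset.sum_congr rfl h1, ← Finset.mul_sum, Finset.sum_comm, Finset.sum_congr rfl h2,
    elev_sum n (N+1) (N+1) β (by rw [hβ])
      (fun η => ((a:ℝ) + 1) / ((N + 1 : ℕ) : ℝ) * ∏ j, ((η j).choose (g j) : ℝ)), liftCoef]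
  have p2 : (N.choose a : ℝ) ≠ 0 := by
    exact_mod_cast (Nat.choose_pos (by omega)).ne'
  have p4 : (1 + a : ℝ) ≠ 0 := by positivity
  have p5 : ((N + 1 : ℕ) : ℝ) ≠ 0 := by positivity
  rw [Finset.mul_sum, Finset.mul_sum, Finset.mul_sum]
  refine Finset.sum_congr rfl fun j _ => ?_
  generalize (∏ i, (((β + Pi.single j 1 : Fin _ → ℕ) i).choose (g i) : ℝ)) = P
  field_simp
  ring

/-- (Structure of the Bernstein-Bezier lift matrix, Section 3.1.2.)  Stated on the unit
`d`-simplex with `d = e + 1` (so `d ≥ 2` becomes `e ≥ 1`), with face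
`F = {x ∈ T_d : x_1 = 0}`.  For a volume multi-index `γ` of weight `N` write `a := γ_0`
and `γ̂ := (γ_1, …, γ_d) : Fin d → ℕ`.  With `L^f_{γ,β} := ℓ_{γ_0} ((Ẽ^N_{N−γ_0})ᵀ L_0)_{γ̂,β}`
one has `M^N L^f = M^f`: for every volume multi-index `α` of weight `N` and face
multi-index `β` of weight `N`,
`Σ_{|γ|=N} (∫_{T_d} b^N_α b^N_γ) · ℓ_{γ_0} · ((Ẽ^N_{N−γ_0})ᵀ L_0)_{γ̂,β}
  = ∫_{T_{d−1}} b^N_α(0,y) b̃^N_β(y) dy`. -/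
theorem stmt14 (e N : ℕ) (he : 1 ≤ e)
    (α : Fin (e + 2) → ℕ) (hα : ∑ j, α j = N)
    (β : Fin (e + 1) → ℕ) (hβ : ∑ j, β j = N) :
    ∑ γ ∈ Finset.Nat.antidiagonalTuple (e + 2) N,
      (∫ x in unitSimplex (e + 1), bernFn (e + 1) N α x * bernFn (e + 1) N γ x)
        * (liftCoef N (γ 0)
            * ∑ δ ∈ Finset.Nat.antidiagonalTuple (e + 1) N,
                elevComp (e + 1) N (γ 0) δ (fun j : Fin (e + 1) => γ j.succ)
                  * L0ent (e + 1) N δ β)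
      = ∫ y in unitSimplex e, bernFn (e + 1) N α (Fin.cons 0 y) * bernFn e N β y := by
  have hα0 : α 0 + ∑ i : Fin (e+1), α i.succ = N := by rw [← hα]; exact (Fin.sum_univ_succ α).symm
  have h1 : ∀ γ ∈ Finset.Nat.antidiagonalTuple (e + 2) N,
      (∫ x in unitSimplex (e + 1), bernFn (e + 1) N α x * bernFn (e + 1) N γ x)
        * (liftCoef N (γ 0)
            * ∑ δ ∈ Finset.Nat.antidiagonalTuple (e + 1) N,
                elevComp (e + 1) N (γ 0) δ (fun j : Fin (e + 1) => γ j.succ)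
                  * L0ent (e + 1) N δ β)
      = ∑ j, (N.factorial : ℝ)^2 / (e + 1 + (N + N)).factorial * ((β j : ℝ) + 1) *
          ((-1:ℝ)^(γ 0) * ((α 0 + γ 0).choose (α 0) : ℝ) *
            ∏ i : Fin (e+1), (((α i.succ + γ i.succ).choose (α i.succ) : ℝ) *
              (((β + Pi.single j 1 : Fin _ → ℕ) i).choose (γ i.succ) : ℝ))) := by
    intro γ hγ
    rw [Finset.Nat.mem_antidiagonalTuple] at hγ
    have hγ0 : ∑ i : Fin (e+1), γ i.succ + γ 0 = N := by
      rw [← hγ, add_comm]; exact (Fin.sum_univ_succ γ).symm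
    rw [int_mass (e+1) N α γ hα hγ, lift_entry (e+1) N (γ 0) (fun j => γ j.succ) β hγ0 hβ,
      Fin.prod_univ_succ, Finset.mul_sum, Finset.mul_sum]
    refine Finset.sum_congr rfl fun j _ => ?_
    rw [Finset.prod_mul_distrib]
    ring
  rw [Finset.sum_congr rfl h1, Finset.sum_comm]
  have h2 : ∀ j : Fin (e+1), ∑ γ ∈ Finset.Nat.antidiagonalTuple (e + 2) N,
      (N.factorial : ℝ)^2 / (e + 1 + (N + N)).factorial * ((β j : ℝ) + 1) *
          ((-1:ℝ)^(γ 0) * ((α 0 + γ 0).choose (α 0) : ℝ) *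
            ∏ i : Fin (e+1), (((α i.succ + γ i.succ).choose (α i.succ) : ℝ) *
              (((β + Pi.single j 1 : Fin _ → ℕ) i).choose (γ i.succ) : ℝ)))
      = (N.factorial : ℝ)^2 / (e + 1 + (N + N)).factorial * ((β j : ℝ) + 1) *
        (if α 0 = 0 then ∏ i : Fin (e+1),
          ((α i.succ + (β + Pi.single j 1 : Fin _ → ℕ) i).choose (α i.succ) : ℝ) else 0) := by
    intro j
    rw [← Finset.mul_sum, sum_adT_succ]
    simp only [Fin.cons_zero, Fin.cons_succ]
    rw [comb_key (e+1) N (α 0) (fun i => α i.succ) (β + Pi.single j 1) hα0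
      (by rw [sum_add_single, hβ])]
  rw [Finset.sum_congr rfl fun j _ => h2 j]
  by_cases h0 : α 0 = 0
  · simp only [if_pos h0, bern_cons_zero e N α h0]
    have hα' : ∑ i : Fin (e+1), α i.succ = N := by omega
    rw [int_mass e N (fun j => α j.succ) β hα' hβ]
    have h3 : ∀ j : Fin (e+1), (N.factorial : ℝ)^2 / (e + 1 + (N + N)).factorial * ((β j : ℝ) + 1) *
        ∏ i : Fin (e+1), ((α i.succ + (β + Pi.single j 1 : Fin _ → ℕ) i).choose (α i.succ) : ℝ)
        = (N.factorial : ℝ)^2 / (e + 1 + (N + N)).factorial * (((α j.succ : ℝ) + β j + 1) *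
          ∏ i : Fin (e+1), ((α i.succ + β i).choose (α i.succ) : ℝ)) := by
      intro j
      rw [mul_assoc]
      congr 1
      refine prod_shift _ _ j _ _ (by intro k hk; simp [hk]) ?_
      simp only [Pi.add_apply, Pi.single_eq_same]
      rw [choose_real, choose_real, ← add_assoc, Nat.factorial_succ, Nat.factorial_succ]
      push_cast
      field_simp
    rw [Finset.sum_congr rfl fun j _ => h3 j, ← Finset.mul_sum, ← Finset.sum_mul,
      Finset.sum_add_distrib, Finset.sum_add_distrib, ← Nat.cast_sum, ← Nat.cast_sum, hα', hβ]
    rw [show e + 1 + (N + N) = (e + (N + N)) + 1 by ring, Nat.factorial_succ]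
    simp only [Finset.sum_const, Finset.card_univ, Fintype.card_fin, nsmul_eq_mul, mul_one]
    generalize (∏ i : Fin (e+1), ((α i.succ + β i).choose (α i.succ) : ℝ)) = P
    push_cast
    have : (e:ℝ) + (N + N) + 1 ≠ 0 := by positivity
    field_simp
    ring
  · simp [if_neg h0, bern_cons_pos e N α h0]
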